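/- Let F be an algebraically closed field of characteristic zero. Every commutative local F-algebra R of dimension 4 as an F-vector space is isomorphic as an F-algebra to exactly one of the following four algebras: F[X]/(X⁴); F[X,Y]/(X³, XY, Y²); F[X,Y]/(X², Y²); F[X,Y,Z]/(X,Y,Z)². Moreover, these four algebras are pairwise non-isomorphic. -/

import Mathlib

open MvPolynomial

/-- The algebra F[X]/(X⁴). -/
abbrev AlgA (F : Type*) [Field F] :=
  Polynomial F ⧸ Ideal.span {(Polynomial.X : Polynomial F) ^ 4}

/-- The algebra F[X,Y]/(X³, XY, Y²). -/
abbrev AlgB (F : Type*) [Field F] :=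
  MvPolynomial (Fin 2) F ⧸
    Ideal.span {(X 0 : MvPolynomial (Fin 2) F) ^ 3, X 0 * X 1, (X 1) ^ 2}

/-- The algebra F[X,Y]/(X², Y²). -/
abbrev AlgC (F : Type*) [Field F] :=
  MvPolynomial (Fin 2) F ⧸
    Ideal.span {(X 0 : MvPolynomial (Fin 2) F) ^ 2, (X 1) ^ 2}

/-- The algebra F[X,Y,Z]/(X,Y,Z)². -/
abbrev AlgD (F : Type*) [Field F] :=
  MvPolynomial (Fin 3) F ⧸
    (Ideal.span (Set.range (X : Fin 3 → MvPolynomial (Fin 3) F))) ^ 2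

section Spanning

variable {F A R : Type*} [Field F] [CommRing A] [Algebra F A] [CommRing R] [Algebra F R]

/-- A subspace containing `1` and stable under a set of algebra generators is everything. -/
lemma span_eq_top_of_adjoin_eq_top {ι : Type*} {S : Set A} (hS : Algebra.adjoin F S = ⊤)
    (v : ι → A) (h1 : 1 ∈ Submodule.span F (Set.range v))
    (hmul : ∀ s ∈ S, ∀ i, s * v i ∈ Submodule.span F (Set.range v)) :
    Submodule.span F (Set.range v) = ⊤ := by
  have key : ∀ a ∈ Algebra.adjoin F S, ∀ w ∈ Submodule.span F (Set.range v),
      a * w ∈ Submodule.span F (Set.range v) := by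
    intro a ha
    induction ha using Algebra.adjoin_induction with
    | mem s hs =>
      intro w hw
      induction hw using Submodule.span_induction with
      | mem x hx => obtain ⟨i, rfl⟩ := hx; exact hmul s hs i
      | zero => simp
      | add x y _ _ hx hy => rw [mul_add]; exact add_mem hx hy
      | smul c x _ hx => rw [mul_smul_comm]; exact Submodule.smul_mem _ _ hx
    | algebraMap r =>
      intro w hw
      rw [← Algebra.smul_def]
      exact Submodule.smul_mem _ _ hw
    | add x y _ _ hx hy => intro w hw; rw [add_mul]; exact add_mem (hx w hw) (hy w hw)
    | mul x y _ _ hx hy => intro w hw; rw [mul_assoc]; exact hx _ (hy w hw)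
  refine eq_top_iff.2 fun a _ => ?_
  simpa using key a (hS ▸ Algebra.mem_top) 1 h1

lemma exists_eq_of_span_eq_top {p q r s : A}
    (h : Submodule.span F (Set.range ![p, q, r, s]) = ⊤) (w : A) :
    ∃ a b c d : F, w = algebraMap F A a * p + algebraMap F A b * q + algebraMap F A c * r +
      algebraMap F A d * s := by
  obtain ⟨c, hc⟩ := (Submodule.mem_span_range_iff_exists_fun F).1
    (h ▸ Submodule.mem_top : w ∈ Submodule.span F (Set.range ![p, q, r, s]))
  refine ⟨c 0, c 1, c 2, c 3, ?_⟩
  rw [← hc]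
  simp [Fin.sum_univ_four, Algebra.smul_def]

lemma linearIndependent_four {p q r s : A}
    (h : ∀ a b c d : F, algebraMap F A a * p + algebraMap F A b * q + algebraMap F A c * r +
      algebraMap F A d * s = 0 → a = 0 ∧ b = 0 ∧ c = 0 ∧ d = 0) :
    LinearIndependent F ![p, q, r, s] := by
  rw [Fintype.linearIndependent_iff]
  intro g hg
  obtain ⟨h0, h1, h2, h3⟩ := h (g 0) (g 1) (g 2) (g 3)
    (by simpa [Fin.sum_univ_four, Algebra.smul_def] using hg)
  intro i
  fin_cases i <;> assumption

lemma eq_zero_of_linearIndependent_four {p q r s : A} (h : LinearIndependent F ![p, q, r, s])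
    {a b c d : F} (h0 : algebraMap F A a * p + algebraMap F A b * q + algebraMap F A c * r +
      algebraMap F A d * s = 0) : a = 0 ∧ b = 0 ∧ c = 0 ∧ d = 0 := by
  have := Fintype.linearIndependent_iff.1 h ![a, b, c, d]
    (by simpa [Fin.sum_univ_four, Algebra.smul_def] using h0)
  exact ⟨this 0, this 1, this 2, this 3⟩

lemma nonempty_algEquiv_of_linearIndependent (hdim : Module.finrank F R = 4) (φ : A →ₐ[F] R)
    {p q r s : A} (hA : Submodule.span F (Set.range ![p, q, r, s]) = ⊤)
    (hR : LinearIndependent F ![φ p, φ q, φ r, φ s]) : Nonempty (R ≃ₐ[F] A) := by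
  refine ⟨(AlgEquiv.ofBijective φ ⟨?_, ?_⟩).symm⟩
  · rw [injective_iff_map_eq_zero]
    intro w hw
    obtain ⟨a, b, c, d, rfl⟩ := exists_eq_of_span_eq_top hA w
    obtain ⟨rfl, rfl, rfl, rfl⟩ := eq_zero_of_linearIndependent_four hR
      (a := a) (b := b) (c := c) (d := d) (by simpa using hw)
    simp
  · intro y
    obtain ⟨a, b, c, d, rfl⟩ := exists_eq_of_span_eq_top
      (hR.span_eq_top_of_card_eq_finrank (by simp [hdim])) y
    exact ⟨algebraMap F A a * p + algebraMap F A b * q + algebraMap F A c * r +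
      algebraMap F A d * s, by simp⟩

end Spanning

section Models

variable {F : Type*} [Field F]

lemma adjoin_range_mk_X {σ : Type*} (I : Ideal (MvPolynomial σ F)) :
    Algebra.adjoin F (Set.range fun i => Ideal.Quotient.mk I (X i)) = ⊤ := by
  have h := (Ideal.Quotient.mkₐ F I).map_adjoin (Set.range X)
  rw [MvPolynomial.adjoin_range_X, ← Set.range_comp, Algebra.map_top,
    (AlgHom.range_eq_top _).2 (Ideal.Quotient.mkₐ_surjective F I)] at h
  exact h.symm

/-- Each of four vectors lies in their span. -/
lemma mem_span_four {A : Type*} [CommRing A] [Algebra F A] (p q r s : A) :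
    p ∈ Submodule.span F (Set.range ![p, q, r, s]) ∧
    q ∈ Submodule.span F (Set.range ![p, q, r, s]) ∧
    r ∈ Submodule.span F (Set.range ![p, q, r, s]) ∧
    s ∈ Submodule.span F (Set.range ![p, q, r, s]) :=
  ⟨Submodule.subset_span ⟨0, rfl⟩, Submodule.subset_span ⟨1, rfl⟩,
    Submodule.subset_span ⟨2, rfl⟩, Submodule.subset_span ⟨3, rfl⟩⟩

namespace AlgA

/-- The class of the variable in `F[X]/(X⁴)`. -/
noncomputable abbrev x (F : Type*) [Field F] : AlgA F := Ideal.Quotient.mk _ Polynomial.X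

lemma x_pow_four : x F ^ 4 = 0 := by
  rw [← map_pow, Ideal.Quotient.eq_zero_iff_mem]
  exact Ideal.subset_span rfl

lemma x_pow_three_ne_zero : x F ^ 3 ≠ 0 := by
  rw [← map_pow, Ne, Ideal.Quotient.eq_zero_iff_mem, Ideal.mem_span_singleton,
    Polynomial.X_pow_dvd_iff]
  intro h
  simpa using h 3 (by norm_num)

lemma span_eq_top : Submodule.span F (Set.range ![1, x F, x F ^ 2, x F ^ 3]) = ⊤ := by
  have hadj : Algebra.adjoin F {x F} = ⊤ := by
    have h := (Ideal.Quotient.mkₐ F (Ideal.span {(Polynomial.X : Polynomial F) ^ 4})).map_adjoin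
      {Polynomial.X}
    rw [Polynomial.adjoin_X, Set.image_singleton, Algebra.map_top,
      (AlgHom.range_eq_top _).2 (Ideal.Quotient.mkₐ_surjective F _)] at h
    exact h.symm
  obtain ⟨h0, h1, h2, h3⟩ := mem_span_four (F := F) 1 (x F) (x F ^ 2) (x F ^ 3)
  refine span_eq_top_of_adjoin_eq_top hadj _ h0 ?_
  rintro _ rfl i
  fin_cases i
  · simpa using h1
  · simpa [← pow_two] using h2
  · simpa [← pow_succ'] using h3
  · simp [← pow_succ', x_pow_four]

/-- The map out of `F[X]/(X⁴)` given by an element with vanishing fourth power. -/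
noncomputable def lift {R : Type*} [CommRing R] [Algebra F R] (t : R) (ht : t ^ 4 = 0) :
    AlgA F →ₐ[F] R :=
  Ideal.Quotient.liftₐ _ (Polynomial.aeval t) fun a ha => by
    have : Ideal.span {(Polynomial.X : Polynomial F) ^ 4} ≤ RingHom.ker (Polynomial.aeval t) :=
      (Ideal.span_singleton_le_iff_mem _).2 (by rw [RingHom.mem_ker]; simp [ht])
    exact this ha

lemma lift_x {R : Type*} [CommRing R] [Algebra F R] (t : R) (ht : t ^ 4 = 0) :
    lift (F := F) t ht (x F) = t :=
  Polynomial.aeval_X t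

end AlgA

namespace AlgB

/-- The class of the first variable in `F[X,Y]/(X³, XY, Y²)`. -/
noncomputable abbrev x (F : Type*) [Field F] : AlgB F := Ideal.Quotient.mk _ (X 0)

/-- The class of the second variable in `F[X,Y]/(X³, XY, Y²)`. -/
noncomputable abbrev y (F : Type*) [Field F] : AlgB F := Ideal.Quotient.mk _ (X 1)

lemma x_pow_three : x F ^ 3 = 0 := by
  rw [← map_pow, Ideal.Quotient.eq_zero_iff_mem]
  exact Ideal.subset_span (by simp)

lemma x_mul_y : x F * y F = 0 := by
  rw [← map_mul, Ideal.Quotient.eq_zero_iff_mem]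
  exact Ideal.subset_span (by simp)

lemma y_sq : y F ^ 2 = 0 := by
  rw [← map_pow, Ideal.Quotient.eq_zero_iff_mem]
  exact Ideal.subset_span (by simp)

/-- The map out of `F[X,Y]/(X³, XY, Y²)` given by two elements satisfying the relations. -/
noncomputable def lift {R : Type*} [CommRing R] [Algebra F R] (s t : R) (hs : s ^ 3 = 0) (hst : s * t = 0)
    (ht : t ^ 2 = 0) : AlgB F →ₐ[F] R :=
  Ideal.Quotient.liftₐ _ (aeval ![s, t]) fun a ha => by
    have : Ideal.span {(X 0 : MvPolynomial (Fin 2) F) ^ 3, X 0 * X 1, (X 1) ^ 2} ≤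
        RingHom.ker (aeval (R := F) ![s, t]) :=
      Ideal.span_le.2 (by simp [Set.insert_subset_iff, hs, hst, ht])
    exact this ha

section lift

variable {R : Type*} [CommRing R] [Algebra F R] (s t : R) (hs : s ^ 3 = 0) (hst : s * t = 0)
    (ht : t ^ 2 = 0)

lemma lift_x : lift (F := F) s t hs hst ht (x F) = s := aeval_X ![s, t] 0

lemma lift_y : lift (F := F) s t hs hst ht (y F) = t := aeval_X ![s, t] 1

end lift

lemma x_sq_ne_zero : x F ^ 2 ≠ 0 := by
  intro h
  have h3 : (Ideal.Quotient.mk (Ideal.span {(Polynomial.X : Polynomial F) ^ 3})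
      Polynomial.X) ^ 3 = 0 := by
    rw [← map_pow, Ideal.Quotient.eq_zero_iff_mem]
    exact Ideal.subset_span rfl
  have h2 := congrArg (lift (F := F) _ 0 h3 (by simp) (by simp)) h
  rw [map_pow, lift_x, map_zero, ← map_pow, Ideal.Quotient.eq_zero_iff_mem,
    Ideal.mem_span_singleton, Polynomial.X_pow_dvd_iff] at h2
  simpa using h2 2 (by norm_num)

instance : Nontrivial (AlgB F) := ⟨_, _, x_sq_ne_zero⟩

lemma span_eq_top : Submodule.span F (Set.range ![1, x F, x F ^ 2, y F]) = ⊤ := by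
  obtain ⟨h0, h1, h2, h3⟩ := mem_span_four (F := F) 1 (x F) (x F ^ 2) (y F)
  refine span_eq_top_of_adjoin_eq_top (adjoin_range_mk_X _) _ h0 ?_
  rintro _ ⟨j, rfl⟩ i
  fin_cases j <;> fin_cases i
  · simpa using h1
  · simpa [← pow_two] using h2
  · simp [← pow_succ', x_pow_three]
  · simp [x_mul_y]
  · simpa using h3
  · simp [mul_comm (y F), x_mul_y]
  · have : y F * x F ^ 2 = 0 := by linear_combination x F * x_mul_y (F := F)
    simp [this]
  · simp [← pow_two, y_sq]

end AlgB

namespace AlgC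

/-- The class of the first variable in `F[X,Y]/(X², Y²)`. -/
noncomputable abbrev x (F : Type*) [Field F] : AlgC F := Ideal.Quotient.mk _ (X 0)

/-- The class of the second variable in `F[X,Y]/(X², Y²)`. -/
noncomputable abbrev y (F : Type*) [Field F] : AlgC F := Ideal.Quotient.mk _ (X 1)

lemma x_sq : x F ^ 2 = 0 := by
  rw [← map_pow, Ideal.Quotient.eq_zero_iff_mem]
  exact Ideal.subset_span (by simp)

lemma y_sq : y F ^ 2 = 0 := by
  rw [← map_pow, Ideal.Quotient.eq_zero_iff_mem]
  exact Ideal.subset_span (by simp)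

/-- The map out of `F[X,Y]/(X², Y²)` given by two elements of square zero. -/
noncomputable def lift {R : Type*} [CommRing R] [Algebra F R] (s t : R) (hs : s ^ 2 = 0) (ht : t ^ 2 = 0) :
    AlgC F →ₐ[F] R :=
  Ideal.Quotient.liftₐ _ (aeval ![s, t]) fun a ha => by
    have : Ideal.span {(X 0 : MvPolynomial (Fin 2) F) ^ 2, (X 1) ^ 2} ≤
        RingHom.ker (aeval (R := F) ![s, t]) :=
      Ideal.span_le.2 (by simp [Set.insert_subset_iff, hs, ht])
    exact this ha

section lift

variable {R : Type*} [CommRing R] [Algebra F R] (s t : R) (hs : s ^ 2 = 0) (ht : t ^ 2 = 0)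

lemma lift_x : lift (F := F) s t hs ht (x F) = s := aeval_X ![s, t] 0

lemma lift_y : lift (F := F) s t hs ht (y F) = t := aeval_X ![s, t] 1

end lift

lemma x_mul_y_ne_zero : x F * y F ≠ 0 := by
  intro h
  have hs : (TrivSqZeroExt.inl DualNumber.eps : DualNumber (DualNumber F)) ^ 2 = 0 := by
    rw [pow_two, TrivSqZeroExt.inl_mul_inl, DualNumber.eps_mul_eps, TrivSqZeroExt.inl_zero]
  have ht : (DualNumber.eps : DualNumber (DualNumber F)) ^ 2 = 0 := by
    rw [pow_two, DualNumber.eps_mul_eps]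
  have h2 := congrArg (lift (F := F) (R := DualNumber (DualNumber F)) _ _ hs ht) h
  rw [map_mul, lift_x, lift_y, map_zero] at h2
  have h3 := congrArg TrivSqZeroExt.snd (congrArg TrivSqZeroExt.snd h2)
  simp at h3

instance : Nontrivial (AlgC F) := ⟨_, _, x_mul_y_ne_zero⟩

lemma span_eq_top : Submodule.span F (Set.range ![1, x F, y F, x F * y F]) = ⊤ := by
  obtain ⟨h0, h1, h2, h3⟩ := mem_span_four (F := F) 1 (x F) (y F) (x F * y F)
  refine span_eq_top_of_adjoin_eq_top (adjoin_range_mk_X _) _ h0 ?_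
  rintro _ ⟨j, rfl⟩ i
  fin_cases j <;> fin_cases i
  · simpa using h1
  · simp [← pow_two, x_sq]
  · simpa using h3
  · have : x F * (x F * y F) = 0 := by linear_combination y F * x_sq (F := F)
    simp [this]
  · simpa using h2
  · simpa [mul_comm] using h3
  · simp [← pow_two, y_sq]
  · have : y F * (x F * y F) = 0 := by linear_combination x F * y_sq (F := F)
    simp [this]

end AlgC

namespace AlgD

/-- The class of the `i`-th variable in `F[X,Y,Z]/(X,Y,Z)²`. -/
noncomputable abbrev x (F : Type*) [Field F] (i : Fin 3) : AlgD F := Ideal.Quotient.mk _ (X i)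

lemma x_mul_x (i j : Fin 3) : x F i * x F j = 0 := by
  rw [← map_mul, Ideal.Quotient.eq_zero_iff_mem, pow_two]
  exact Ideal.mul_mem_mul (Ideal.subset_span ⟨i, rfl⟩) (Ideal.subset_span ⟨j, rfl⟩)

/-- The map out of `F[X,Y,Z]/(X,Y,Z)²` given by three elements with vanishing products. -/
noncomputable def lift {R : Type*} [CommRing R] [Algebra F R] (t : Fin 3 → R) (ht : ∀ i j, t i * t j = 0) :
    AlgD F →ₐ[F] R :=
  Ideal.Quotient.liftₐ _ (aeval t) fun a ha => by
    have : Ideal.span (Set.range (X : Fin 3 → MvPolynomial (Fin 3) F)) ^ 2 ≤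
        RingHom.ker (aeval (R := F) t) := by
      rw [pow_two, Ideal.span_mul_span', Ideal.span_le]
      rintro _ ⟨_, ⟨i, rfl⟩, _, ⟨j, rfl⟩, rfl⟩
      simp [ht]
    exact this ha

lemma lift_x {R : Type*} [CommRing R] [Algebra F R] (t : Fin 3 → R)
    (ht : ∀ i j, t i * t j = 0) (i : Fin 3) : lift (F := F) t ht (x F i) = t i :=
  aeval_X t i

instance : Nontrivial (AlgD F) :=
  (lift (F := F) (0 : Fin 3 → F) (by simp)).toRingHom.domain_nontrivial

lemma span_eq_top : Submodule.span F (Set.range ![1, x F 0, x F 1, x F 2]) = ⊤ := by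
  obtain ⟨h0, h1, h2, h3⟩ := mem_span_four (F := F) 1 (x F 0) (x F 1) (x F 2)
  refine span_eq_top_of_adjoin_eq_top (adjoin_range_mk_X _) _ h0 ?_
  rintro _ ⟨j, rfl⟩ i
  fin_cases i
  · fin_cases j
    · simpa using h1
    · simpa using h2
    · simpa using h3
  all_goals simp [x_mul_x]

end AlgD

end Models

section Invariants

variable {F A B : Type*} [Field F] [CommRing A] [Algebra F A] [CommRing B] [Algebra F B]

lemma exists_eq_of_isNilpotent [Nontrivial A] {p q r u : A}
    (h : Submodule.span F (Set.range ![1, p, q, r]) = ⊤) (hp : IsNilpotent p)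
    (hq : IsNilpotent q) (hr : IsNilpotent r) (hu : IsNilpotent u) :
    ∃ b c d : F, u = algebraMap F A b * p + algebraMap F A c * q + algebraMap F A d * r := by
  obtain ⟨a, b, c, d, rfl⟩ := exists_eq_of_span_eq_top h u
  have hmul : ∀ (b : F) {p : A}, IsNilpotent p → IsNilpotent (algebraMap F A b * p) :=
    fun b _ hp => (Commute.all _ _).isNilpotent_mul_left hp
  have hn := (Commute.all _ _).isNilpotent_add
    ((Commute.all _ _).isNilpotent_add (hmul b hp) (hmul c hq)) (hmul d hr)
  have ha : IsNilpotent (algebraMap F A a) := by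
    convert (Commute.all _ _).isNilpotent_sub hu hn using 1
    ring
  rw [IsNilpotent.map_iff (algebraMap F A).injective] at ha
  exact ⟨b, c, d, by simp [ha.eq_zero]⟩

namespace AlgB

lemma exists_eq_of_isNilpotent {u : AlgB F} (hu : IsNilpotent u) :
    ∃ b c d : F, u = algebraMap F (AlgB F) b * x F + algebraMap F (AlgB F) c * x F ^ 2 +
      algebraMap F (AlgB F) d * y F :=
  have hx : IsNilpotent (x F) := ⟨3, x_pow_three⟩
  _root_.exists_eq_of_isNilpotent span_eq_top hx (hx.pow_of_pos two_ne_zero) ⟨2, y_sq⟩ hu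

lemma pow_three_eq_zero {u : AlgB F} (hu : IsNilpotent u) : u ^ 3 = 0 := by
  obtain ⟨b, c, d, rfl⟩ := exists_eq_of_isNilpotent hu
  linear_combination (algebraMap F (AlgB F) b + algebraMap F _ c * x F) ^ 3 *
      x_pow_three (F := F) +
    3 * (algebraMap F (AlgB F) b + algebraMap F _ c * x F) * algebraMap F _ d *
      ((algebraMap F (AlgB F) b + algebraMap F _ c * x F) * x F + algebraMap F _ d * y F) *
      x_mul_y (F := F) +
    algebraMap F _ d ^ 3 * y F * y_sq (F := F)

lemma exists_eq_of_sq_eq_zero {u : AlgB F} (hu : u ^ 2 = 0) :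
    ∃ c d : F, u = algebraMap F _ c * x F ^ 2 + algebraMap F _ d * y F := by
  obtain ⟨b, c, d, rfl⟩ := exists_eq_of_isNilpotent ⟨2, hu⟩
  have h : algebraMap F (AlgB F) (b ^ 2) * x F ^ 2 = 0 := by
    rw [map_pow]
    linear_combination hu - algebraMap F (AlgB F) c *
        (2 * algebraMap F _ b + algebraMap F _ c * x F) * x_pow_three (F := F) -
      2 * algebraMap F _ d * (algebraMap F (AlgB F) b + algebraMap F _ c * x F) *
        x_mul_y (F := F) - algebraMap F _ d ^ 2 * y_sq (F := F)
  rw [← Algebra.smul_def, smul_eq_zero_iff_left x_sq_ne_zero] at h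
  obtain rfl := pow_eq_zero_iff (two_ne_zero) |>.1 h
  exact ⟨c, d, by simp⟩

lemma mul_eq_zero_of_sq_eq_zero {u v : AlgB F} (hu : u ^ 2 = 0) (hv : v ^ 2 = 0) :
    u * v = 0 := by
  obtain ⟨c, d, rfl⟩ := exists_eq_of_sq_eq_zero hu
  obtain ⟨c', d', rfl⟩ := exists_eq_of_sq_eq_zero hv
  linear_combination algebraMap F (AlgB F) c * algebraMap F _ c' * x F * x_pow_three (F := F) +
    (algebraMap F (AlgB F) c * algebraMap F _ d' + algebraMap F _ c' * algebraMap F _ d) * x F *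
      x_mul_y (F := F) + algebraMap F _ d * algebraMap F _ d' * y_sq (F := F)

end AlgB

namespace AlgC

lemma exists_eq_of_isNilpotent {u : AlgC F} (hu : IsNilpotent u) :
    ∃ b c d : F, u = algebraMap F (AlgC F) b * x F + algebraMap F (AlgC F) c * y F +
      algebraMap F (AlgC F) d * (x F * y F) :=
  have hx : IsNilpotent (x F) := ⟨2, x_sq⟩
  have hy : IsNilpotent (y F) := ⟨2, y_sq⟩
  have hxy : IsNilpotent (x F * y F) := (Commute.all _ _).isNilpotent_mul_left hy
  _root_.exists_eq_of_isNilpotent (F := F) (A := AlgC F) span_eq_top hx hy hxy hu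

lemma pow_three_eq_zero {u : AlgC F} (hu : IsNilpotent u) : u ^ 3 = 0 := by
  obtain ⟨b, c, d, rfl⟩ := exists_eq_of_isNilpotent hu
  have hx := x_sq (F := F)
  have hy := y_sq (F := F)
  generalize algebraMap F (AlgC F) b = b
  generalize algebraMap F (AlgC F) c = c
  generalize algebraMap F (AlgC F) d = d
  generalize x F = x at *
  generalize y F = y at *
  grind

/-- In characteristic not two, `X + Y` has nonzero square and vanishing cube. -/
lemma exists_sq_ne_zero [CharZero F] : ∃ u : AlgC F, u ^ 3 = 0 ∧ u ^ 2 ≠ 0 := by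
  refine ⟨x F + y F, ?_, fun h => x_mul_y_ne_zero (F := F) ?_⟩
  · linear_combination (x F + 3 * y F) * x_sq (F := F) + (y F + 3 * x F) * y_sq (F := F)
  · have h2 : algebraMap F (AlgC F) 2 * (x F * y F) = 0 := by
      rw [map_ofNat]
      linear_combination h - x_sq (F := F) - y_sq (F := F)
    rw [← Algebra.smul_def] at h2
    exact (smul_eq_zero_iff_right two_ne_zero).1 h2

end AlgC

namespace AlgD

lemma exists_eq_of_isNilpotent {u : AlgD F} (hu : IsNilpotent u) :
    ∃ b c d : F, u = algebraMap F (AlgD F) b * x F 0 + algebraMap F (AlgD F) c * x F 1 +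
      algebraMap F (AlgD F) d * x F 2 :=
  have hx : ∀ i, IsNilpotent (x F i) := fun i => ⟨2, by rw [pow_two, x_mul_x]⟩
  _root_.exists_eq_of_isNilpotent (F := F) (A := AlgD F) span_eq_top (hx 0) (hx 1) (hx 2) hu

lemma sq_eq_zero {u : AlgD F} (hu : IsNilpotent u) : u ^ 2 = 0 := by
  obtain ⟨b, c, d, rfl⟩ := exists_eq_of_isNilpotent hu
  simp only [pow_two, add_mul, mul_add, mul_mul_mul_comm, x_mul_x, mul_zero, add_zero]

end AlgD

/-- An isomorphism transports the vanishing of a power of all nilpotent elements. -/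
lemma isEmpty_algEquiv_of_pow_ne_zero {n : ℕ} {u : A} (hu : IsNilpotent u) (hun : u ^ n ≠ 0)
    (hB : ∀ v : B, IsNilpotent v → v ^ n = 0) : IsEmpty (A ≃ₐ[F] B) :=
  ⟨fun e => hun (e.injective (by rw [map_pow, hB _ (hu.map e), map_zero]))⟩

end Invariants

section Classification

variable {F R : Type*} [Field F] [CommRing R] [Algebra F R]

lemma pow_finrank_eq_zero_of_isNilpotent [Module.Finite F R] {x : R} (h : IsNilpotent x) :
    x ^ Module.finrank F R = 0 := by
  have h1 := (h.map (Algebra.lmul F R)).charpoly_eq_X_pow_finrank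
  have h2 := LinearMap.aeval_self_charpoly (Algebra.lmul F R x)
  rw [h1, map_pow, Polynomial.aeval_X, ← map_pow] at h2
  simpa using congrArg (fun f => f 1) h2

lemma exists_isNilpotent_sub_algebraMap [IsAlgClosed F] [IsLocalRing R] [Module.Finite F R]
    (r : R) : ∃ a : F, IsNilpotent (r - algebraMap F R a) := by
  have : IsArtinianRing R := IsArtinianRing.of_finite F R
  obtain ⟨a, ha⟩ := (IsAlgClosed.algebraMap_bijective_of_isIntegral
    (k := F) (K := IsLocalRing.ResidueField R)).2 (IsLocalRing.residue R r)
  refine ⟨a, ?_⟩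
  rw [Ring.KrullDimLE.isNilpotent_iff_mem_maximalIdeal, ← IsLocalRing.residue_eq_zero_iff,
    map_sub, ← ha, sub_eq_zero]
  rfl

lemma exists_isNilpotent_linearIndependent_snoc [IsAlgClosed F] [IsLocalRing R]
    [Module.Finite F R] {n : ℕ} {v : Fin n → R} (hv : LinearIndependent F v)
    (h1 : 1 ∈ Submodule.span F (Set.range v)) (hn : n < Module.finrank F R) :
    ∃ x : R, IsNilpotent x ∧ LinearIndependent F (Fin.snoc v x : Fin (n + 1) → R) := by
  obtain ⟨z, hz⟩ := exists_linearIndependent_snoc_of_lt_finrank hv hn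
  obtain ⟨a, ha⟩ := exists_isNilpotent_sub_algebraMap (F := F) z
  refine ⟨_, ha, ?_⟩
  rw [linearIndependent_finSnoc] at hz ⊢
  refine ⟨hv, fun h => hz.2 ?_⟩
  have := add_mem h (Submodule.smul_mem _ a h1)
  rwa [← Algebra.algebraMap_eq_smul_one, sub_add_cancel] at this

lemma nonempty_algEquiv_AlgA (hdim : Module.finrank F R = 4) {x : R} (hx : x ^ 4 = 0)
    (hx3 : x ^ 3 ≠ 0) : Nonempty (R ≃ₐ[F] AlgA F) := by
  refine nonempty_algEquiv_of_linearIndependent hdim (AlgA.lift x hx) AlgA.span_eq_top ?_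
  simp only [map_one, map_pow, AlgA.lift_x]
  refine linearIndependent_four fun a b c d h => ?_
  have ha : a • x ^ 3 = 0 := by
    rw [Algebra.smul_def]
    linear_combination x ^ 3 * h - (algebraMap F R b + algebraMap F R c * x +
      algebraMap F R d * x ^ 2) * hx
  obtain rfl := (smul_eq_zero_iff_left hx3).1 ha
  rw [map_zero] at h
  have hb : b • x ^ 3 = 0 := by
    rw [Algebra.smul_def]
    linear_combination x ^ 2 * h - (algebraMap F R c + algebraMap F R d * x) * hx
  obtain rfl := (smul_eq_zero_iff_left hx3).1 hb
  rw [map_zero] at h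
  have hc : c • x ^ 3 = 0 := by
    rw [Algebra.smul_def]
    linear_combination x * h - algebraMap F R d * hx
  obtain rfl := (smul_eq_zero_iff_left hx3).1 hc
  have hd : d • x ^ 3 = 0 := by
    rw [Algebra.smul_def]
    simpa using h
  exact ⟨rfl, rfl, rfl, (smul_eq_zero_iff_left hx3).1 hd⟩

lemma nonempty_algEquiv_AlgD [IsAlgClosed F] [CharZero F] [IsLocalRing R]
    (hdim : Module.finrank F R = 4) (hsq : ∀ x : R, IsNilpotent x → x ^ 2 = 0) :
    Nonempty (R ≃ₐ[F] AlgD F) := by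
  have : Module.Finite F R := Module.finite_of_finrank_eq_succ hdim
  have hmul : ∀ x y : R, IsNilpotent x → IsNilpotent y → x * y = 0 := by
    intro x y hx hy
    have h2 : (2 : F) • (x * y) = 0 := by
      rw [Algebra.smul_def, map_ofNat]
      linear_combination hsq _ ((Commute.all x y).isNilpotent_add hx hy) - hsq x hx - hsq y hy
    exact (smul_eq_zero_iff_right two_ne_zero).1 h2
  have h1 : LinearIndependent F ![(1 : R)] :=
    LinearIndependent.of_subsingleton 0 one_ne_zero
  obtain ⟨x, hx, h2⟩ := exists_isNilpotent_linearIndependent_snoc h1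
    (Submodule.subset_span ⟨0, rfl⟩) (by omega)
  obtain ⟨y, hy, h3⟩ := exists_isNilpotent_linearIndependent_snoc h2
    (Submodule.subset_span ⟨0, rfl⟩) (by omega)
  obtain ⟨z, hz, h4⟩ := exists_isNilpotent_linearIndependent_snoc h3
    (Submodule.subset_span ⟨0, rfl⟩) (by omega)
  have hnil : ∀ i, IsNilpotent (![x, y, z] i) := by
    intro i
    fin_cases i <;> assumption
  refine nonempty_algEquiv_of_linearIndependent hdim
    (AlgD.lift ![x, y, z] fun i j => hmul _ _ (hnil i) (hnil j)) AlgD.span_eq_top ?_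
  simp only [map_one, AlgD.lift_x]
  convert h4 using 1
  ext i
  fin_cases i <;> rfl

/-- The basis `1, x, x², y` obtained from an element `x` with `x² ≠ 0` when all nilpotent elements
have vanishing cube. -/
lemma exists_basis_of_pow_three_eq_zero [IsAlgClosed F] [CharZero F] [IsLocalRing R]
    (hdim : Module.finrank F R = 4) (hcube : ∀ x : R, IsNilpotent x → x ^ 3 = 0) {x : R}
    (hx : IsNilpotent x) (hx2 : x ^ 2 ≠ 0) :
    ∃ (y : R) (c : F), x * y = 0 ∧ y ^ 2 = c • x ^ 2 ∧
      LinearIndependent F ![1, x, x ^ 2, y] := by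
  have : Module.Finite F R := Module.finite_of_finrank_eq_succ hdim
  have hx3 := hcube x hx
  have h3 : LinearIndependent F ![1, x, x ^ 2] := by
    rw [Fintype.linearIndependent_iff]
    intro g hg
    simp only [Fin.sum_univ_three, Matrix.cons_val, Algebra.smul_def] at hg
    have h0 : g 0 • x ^ 2 = 0 := by
      rw [Algebra.smul_def]
      linear_combination x ^ 2 * hg - (algebraMap F R (g 1) + algebraMap F R (g 2) * x) * hx3
    rw [smul_eq_zero_iff_left hx2] at h0
    rw [h0, map_zero] at hg
    have h1 : g 1 • x ^ 2 = 0 := by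
      rw [Algebra.smul_def]
      linear_combination x * hg - algebraMap F R (g 2) * hx3
    rw [smul_eq_zero_iff_left hx2] at h1
    rw [h1, map_zero] at hg
    have h2 : g 2 • x ^ 2 = 0 := by
      rw [Algebra.smul_def]
      linear_combination hg
    rw [smul_eq_zero_iff_left hx2] at h2
    intro i
    fin_cases i <;> assumption
  obtain ⟨z, hz, h4⟩ := exists_isNilpotent_linearIndependent_snoc h3
    (Submodule.subset_span ⟨0, rfl⟩) (by omega)
  have h4 : LinearIndependent F ![1, x, x ^ 2, z] := by
    convert h4 using 1
    ext i
    fin_cases i <;> rfl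
  have hz3 := hcube z hz
  have hxxz : x ^ 2 * z = 0 := by
    have h6 : (6 : F) • (x ^ 2 * z) = 0 := by
      rw [Algebra.smul_def, map_ofNat]
      linear_combination hcube _ ((Commute.all x z).isNilpotent_add hx hz) -
        hcube _ ((Commute.all x z).isNilpotent_sub hx hz) - 2 * hz3
    exact (smul_eq_zero_iff_right (by norm_num)).1 h6
  have hspan := exists_eq_of_span_eq_top (h4.span_eq_top_of_card_eq_finrank (by simp [hdim]))
  obtain ⟨l, hl⟩ : ∃ l : F, x * z = algebraMap F R l * x ^ 2 := by
    obtain ⟨a, b, c, d, h⟩ := hspan (x * z)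
    have ha : a • x ^ 2 = 0 := by
      rw [Algebra.smul_def]
      linear_combination -x ^ 2 * h - (algebraMap F R b + algebraMap F R c * x - z) * hx3 -
        algebraMap F R d * hxxz
    obtain rfl := (smul_eq_zero_iff_left hx2).1 ha
    rw [map_zero] at h
    have hb : b • x ^ 2 + d • (x * z) = 0 := by
      rw [Algebra.smul_def, Algebra.smul_def]
      linear_combination -x * h - algebraMap F R c * hx3 + hxxz
    by_cases hd : d = 0
    · obtain rfl := (smul_eq_zero_iff_left hx2).1 (by rwa [hd, zero_smul, add_zero] at hb : b • x ^ 2 = 0)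
      exact ⟨c, by simpa [hd] using h⟩
    · refine ⟨-(d⁻¹ * b), ?_⟩
      have := congrArg (d⁻¹ • ·) hb
      simp only [smul_add, smul_smul, inv_mul_cancel₀ hd, one_smul, smul_zero] at this
      rw [map_neg, neg_mul, ← Algebra.smul_def]
      linear_combination this
  obtain ⟨y, hy⟩ : ∃ y, y = z - algebraMap F R l * x := ⟨_, rfl⟩
  have hxy : x * y = 0 := by rw [hy]; linear_combination hl
  have hy3 : y ^ 3 = 0 := hcube y (hy ▸ (Commute.all _ _).isNilpotent_sub hz
    ((Commute.all _ _).isNilpotent_mul_left hx))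
  obtain ⟨c, hc⟩ : ∃ c : F, y ^ 2 = c • x ^ 2 := by
    obtain ⟨a, b, c, d, h⟩ := hspan (y ^ 2)
    obtain rfl : z = y + algebraMap F R l * x := by rw [hy]; ring
    have ha : a • x ^ 2 = 0 := by
      rw [Algebra.smul_def]
      linear_combination -x ^ 2 * h - (algebraMap F R b + algebraMap F R c * x +
        algebraMap F R d * algebraMap F R l) * hx3 + (x * y - algebraMap F R d * x) * hxy
    obtain rfl := (smul_eq_zero_iff_left hx2).1 ha
    rw [map_zero] at h
    have hb : (b + d * l) • x ^ 2 = 0 := by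
      rw [Algebra.smul_def, map_add, map_mul]
      linear_combination -x * h - algebraMap F R c * hx3 + (y - algebraMap F R d) * hxy
    have hb := (smul_eq_zero_iff_left hx2).1 hb
    have hbR : algebraMap F R b + algebraMap F R d * algebraMap F R l = 0 := by
      rw [← map_mul, ← map_add, hb, map_zero]
    have hd : d • y ^ 2 = 0 := by
      rw [Algebra.smul_def]
      linear_combination -y * h + hy3 - x * y * hbR - algebraMap F R c * x * hxy
    rcases smul_eq_zero.1 hd with rfl | h0
    · refine ⟨c, ?_⟩
      rw [map_zero] at h hbR
      rw [Algebra.smul_def]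
      linear_combination h + x * hbR
    · exact ⟨0, by simpa using h0⟩
  refine ⟨y, c, hxy, hc, linearIndependent_four fun a b c d h => ?_⟩
  obtain ⟨ha, hb, hc, hd⟩ := eq_zero_of_linearIndependent_four h4 (a := a) (b := b - d * l)
    (c := c) (d := d) (by rw [map_sub, map_mul]; rw [hy] at h; linear_combination h)
  exact ⟨ha, by simpa [hd] using hb, hc, hd⟩

lemma nonempty_algEquiv_AlgB_or_AlgC [IsAlgClosed F] [CharZero F] [IsLocalRing R]
    (hdim : Module.finrank F R = 4) (hcube : ∀ x : R, IsNilpotent x → x ^ 3 = 0) {x : R}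
    (hx : IsNilpotent x) (hx2 : x ^ 2 ≠ 0) :
    Nonempty (R ≃ₐ[F] AlgB F) ∨ Nonempty (R ≃ₐ[F] AlgC F) := by
  obtain ⟨y, c, hxy, hc, hli⟩ := exists_basis_of_pow_three_eq_zero hdim hcube hx hx2
  rw [Algebra.smul_def] at hc
  by_cases hc0 : c = 0
  · left
    refine nonempty_algEquiv_of_linearIndependent hdim
      (AlgB.lift x y (hcube x hx) hxy (by simpa [hc0] using hc)) AlgB.span_eq_top ?_
    simpa only [map_one, map_pow, AlgB.lift_x, AlgB.lift_y] using hli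
  · right
    obtain ⟨s, hs⟩ := IsAlgClosed.exists_pow_nat_eq (-c⁻¹) (n := 2) (by norm_num)
    have hs0 : s ≠ 0 := by rintro rfl; simp [hc0] at hs
    have hsc : algebraMap F R s ^ 2 * algebraMap F R c = -1 := by
      rw [← map_pow, hs, ← map_mul, neg_mul, inv_mul_cancel₀ hc0, map_neg, map_one]
    have hu : (x + algebraMap F R s * y) ^ 2 = 0 := by
      linear_combination 2 * algebraMap F R s * hxy + algebraMap F R s ^ 2 * hc + x ^ 2 * hsc
    have hv : (x - algebraMap F R s * y) ^ 2 = 0 := by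
      linear_combination -2 * algebraMap F R s * hxy + algebraMap F R s ^ 2 * hc + x ^ 2 * hsc
    have huv : (x + algebraMap F R s * y) * (x - algebraMap F R s * y) = 2 * x ^ 2 := by
      linear_combination -algebraMap F R s ^ 2 * hc - x ^ 2 * hsc
    refine nonempty_algEquiv_of_linearIndependent hdim (AlgC.lift _ _ hu hv) AlgC.span_eq_top ?_
    simp only [map_one, map_mul, AlgC.lift_x, AlgC.lift_y, huv]
    refine linearIndependent_four fun a b c d h => ?_
    obtain ⟨ha, hb, hc, hd⟩ := eq_zero_of_linearIndependent_four hli (a := a) (b := b + c)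
      (c := d * 2) (d := (b - c) * s) (by
        simp only [map_sub, map_mul, map_add, map_ofNat]
        linear_combination h)
    have hbc : b - c = 0 := (mul_eq_zero.1 hd).resolve_right hs0
    have hb2 : b * 2 = 0 := by linear_combination hb + hbc
    have hb0 : b = 0 := (mul_eq_zero.1 hb2).resolve_right two_ne_zero
    exact ⟨ha, hb0, by linear_combination hb0 - hbc,
      (mul_eq_zero.1 hc).resolve_right two_ne_zero⟩

end Classification

/-- over an algebraically closed field F of characteristic zero, every
commutative local F-algebra of F-dimension 4 is isomorphic to exactly one of F[X]/(X⁴),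
F[X,Y]/(X³, XY, Y²), F[X,Y]/(X², Y²), F[X,Y,Z]/(X,Y,Z)², and these four are pairwise
non-isomorphic. -/
theorem stmt_9 (F : Type*) [Field F] [IsAlgClosed F] [CharZero F]
    (R : Type*) [CommRing R] [Algebra F R] [IsLocalRing R]
    (hdim : Module.finrank F R = 4) :
    (Nonempty (R ≃ₐ[F] AlgA F) ∨ Nonempty (R ≃ₐ[F] AlgB F) ∨
      Nonempty (R ≃ₐ[F] AlgC F) ∨ Nonempty (R ≃ₐ[F] AlgD F)) ∧
    IsEmpty (AlgA F ≃ₐ[F] AlgB F) ∧ IsEmpty (AlgA F ≃ₐ[F] AlgC F) ∧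
    IsEmpty (AlgA F ≃ₐ[F] AlgD F) ∧ IsEmpty (AlgB F ≃ₐ[F] AlgC F) ∧
    IsEmpty (AlgB F ≃ₐ[F] AlgD F) ∧ IsEmpty (AlgC F ≃ₐ[F] AlgD F) := by
  have : Module.Finite F R := Module.finite_of_finrank_eq_succ hdim
  have hA : IsNilpotent (AlgA.x F) := ⟨4, AlgA.x_pow_four⟩
  obtain ⟨w, hw3, hw2⟩ := AlgC.exists_sq_ne_zero (F := F)
  refine ⟨?_, isEmpty_algEquiv_of_pow_ne_zero hA AlgA.x_pow_three_ne_zero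
      fun _ => AlgB.pow_three_eq_zero,
    isEmpty_algEquiv_of_pow_ne_zero hA AlgA.x_pow_three_ne_zero fun _ => AlgC.pow_three_eq_zero,
    isEmpty_algEquiv_of_pow_ne_zero hA AlgA.x_pow_three_ne_zero
      fun _ hv => pow_eq_zero_of_le (by norm_num) (AlgD.sq_eq_zero hv), ⟨fun e => ?_⟩,
    isEmpty_algEquiv_of_pow_ne_zero ⟨3, AlgB.x_pow_three⟩ AlgB.x_sq_ne_zero
      fun _ => AlgD.sq_eq_zero,
    isEmpty_algEquiv_of_pow_ne_zero ⟨3, hw3⟩ hw2 fun _ => AlgD.sq_eq_zero⟩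
  · by_cases hcube : ∀ x : R, IsNilpotent x → x ^ 3 = 0
    · by_cases hsq : ∀ x : R, IsNilpotent x → x ^ 2 = 0
      · exact .inr (.inr (.inr (nonempty_algEquiv_AlgD hdim hsq)))
      · push Not at hsq
        obtain ⟨x, hx, hx2⟩ := hsq
        rcases nonempty_algEquiv_AlgB_or_AlgC hdim hcube hx hx2 with h | h
        · exact .inr (.inl h)
        · exact .inr (.inr (.inl h))
    · push Not at hcube
      obtain ⟨x, hx, hx3⟩ := hcube
      exact .inl (nonempty_algEquiv_AlgA hdim
        (hdim ▸ pow_finrank_eq_zero_of_isNilpotent (F := F) hx) hx3)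
  · refine AlgC.x_mul_y_ne_zero (F := F) (e.symm.injective ?_)
    rw [map_mul, map_zero]
    exact AlgB.mul_eq_zero_of_sq_eq_zero (by rw [← map_pow, AlgC.x_sq, map_zero])
      (by rw [← map_pow, AlgC.y_sq, map_zero])
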